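/- Whitney's theorem: if G and H are connected simple graphs, neither isomorphic to K_3 or K_{1,3}, and their line graphs l(G) and l(H) are isomorphic, then G and H are isomorphic. -/

import Mathlib

open SimpleGraph

/-- The star `K_{1,3}` (the claw) on four vertices, with center `0`. -/
def claw : SimpleGraph (Fin 4) := SimpleGraph.fromRel (fun i _ => i = 0)

namespace SimpleGraph

variable {V W : Type*} {G : SimpleGraph V} {H : SimpleGraph W}

/-- Two edges have a common endpoint (possibly because they are equal). -/
def EdgesMeet (e e' : Sym2 V) : Prop := ∃ v, v ∈ e ∧ v ∈ e'

/-- A map of edges sends any three distinct edges with a common endpoint to three edges with a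
common endpoint. -/
def PreservesClaws (φ : G.edgeSet → H.edgeSet) : Prop :=
  ∀ a b c : G.edgeSet, a ≠ b → a ≠ c → b ≠ c →
    (∃ v, v ∈ a.1 ∧ v ∈ b.1 ∧ v ∈ c.1) → ∃ w, w ∈ (φ a).1 ∧ w ∈ (φ b).1 ∧ w ∈ (φ c).1

theorem edgesMeet_map_iff (φ : G.lineGraph ≃g H.lineGraph) (e e' : G.edgeSet) :
    EdgesMeet (φ e).1 (φ e').1 ↔ EdgesMeet e.1 e'.1 := by
  by_cases h : e = e'
  · subst h
    exact ⟨fun _ => ⟨_, Sym2.out_fst_mem _, Sym2.out_fst_mem _⟩,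
      fun _ => ⟨_, Sym2.out_fst_mem _, Sym2.out_fst_mem _⟩⟩
  · have := φ.map_adj_iff (v := e) (w := e')
    rw [lineGraph_adj_iff_exists, lineGraph_adj_iff_exists] at this
    simpa [h, EdgesMeet] using this

theorem Connected.exists_adj_of_edgeSet_nonempty (hG : G.Connected) (h : G.edgeSet.Nonempty)
    (v : V) : ∃ u, G.Adj v u := by
  obtain ⟨⟨a, b⟩, hab⟩ := h
  have : Nontrivial V := ⟨a, b, G.ne_of_adj hab⟩
  exact hG.preconnected.exists_adj_of_nontrivial v

theorem eq_of_mem_map_of_ne {φ : G.edgeSet → H.edgeSet} (hφ : Function.Injective φ)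
    {a b : G.edgeSet} (hab : a ≠ b) {p q : W} (hpa : p ∈ (φ a).1) (hpb : p ∈ (φ b).1)
    (hqa : q ∈ (φ a).1) (hqb : q ∈ (φ b).1) : p = q := by
  by_contra hpq
  exact hab (hφ (Subtype.ext (Sym2.eq_of_ne_mem hpq hpa hqa hpb hqb)))

theorem mem_map_of_mem_map_of_ne (φ : G.lineGraph ≃g H.lineGraph)
    (h₁ : PreservesClaws φ) (h₂ : PreservesClaws φ.symm) {u v : V} (huv : u ≠ v) {e a₀ : G.edgeSet}
    (he : e.1 = s(u, v)) (hne : a₀ ≠ e) (hu : u ∈ a₀.1) {p q : W} (hφe : (φ e).1 = s(p, q))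
    (hp : p ∈ (φ a₀).1) :
    (∀ a : G.edgeSet, u ∈ a.1 → p ∈ (φ a).1) ∧ (∀ b : G.edgeSet, v ∈ b.1 → q ∈ (φ b).1) := by
  have hue : u ∈ e.1 := by simp [he]
  have hve : v ∈ e.1 := by simp [he]
  have hpe : p ∈ (φ e).1 := by simp [hφe]
  have hqe : q ∈ (φ e).1 := by simp [hφe]
  constructor
  · intro a hua
    by_cases hae : a = e
    · rwa [hae]
    by_cases haa : a = a₀
    · rwa [haa]
    obtain ⟨w, hwa, hwa₀, hwe⟩ := h₁ a a₀ e haa hae hne ⟨u, hua, hu, hue⟩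
    rwa [eq_of_mem_map_of_ne φ.injective hne hp hpe hwa₀ hwe]
  · intro b hvb
    by_cases hbe : b = e
    · rwa [hbe]
    have hub : u ∉ b.1 := fun hub =>
      hbe (Subtype.ext (Sym2.eq_of_ne_mem huv hub hvb hue hve))
    have hva₀ : v ∉ a₀.1 := fun hva₀ =>
      hne (Subtype.ext (Sym2.eq_of_ne_mem huv hu hva₀ hue hve))
    have hpb : p ∉ (φ b).1 := by
      intro hpb
      have hba : b ≠ a₀ := by rintro rfl; exact hub hu
      obtain ⟨t, htb, hta, hte⟩ := h₂ (φ b) (φ a₀) (φ e) (φ.injective.ne hba)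
        (φ.injective.ne hbe) (φ.injective.ne hne) ⟨p, hpb, hp, hpe⟩
      rw [RelIso.symm_apply_apply] at htb hta hte
      rw [he, Sym2.mem_iff] at hte
      rcases hte with rfl | rfl
      · exact hub htb
      · exact hva₀ hta
    obtain ⟨w, hwb, hwe⟩ := (edgesMeet_map_iff φ b e).2 ⟨v, hvb, hve⟩
    rw [hφe, Sym2.mem_iff] at hwe
    rcases hwe with rfl | rfl
    · exact absurd hwb hpb
    · exact hwb

/-- The endpoints of an edge can be mapped to the endpoints of its image compatibly with the edges
incident to either endpoint. -/
theorem exists_endpoint_labelling (φ : G.lineGraph ≃g H.lineGraph)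
    (h₁ : PreservesClaws φ) (h₂ : PreservesClaws φ.symm) (e : G.edgeSet) :
    ∃ l : V → W, (φ e).1 = e.1.map l ∧ ∀ u ∈ e.1, ∀ a : G.edgeSet, u ∈ a.1 → l u ∈ (φ a).1 := by
  classical
  suffices ∃ u v p q, u ≠ v ∧ e.1 = s(u, v) ∧ (φ e).1 = s(p, q) ∧
      (∀ a : G.edgeSet, u ∈ a.1 → p ∈ (φ a).1) ∧ (∀ b : G.edgeSet, v ∈ b.1 → q ∈ (φ b).1) by
    obtain ⟨u, v, p, q, huv, he, hφe, hu, hv⟩ := this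
    refine ⟨fun x => if x = u then p else q, by simp [he, hφe, huv.symm], fun x hx a hxa => ?_⟩
    rw [he, Sym2.mem_iff] at hx
    rcases hx with rfl | rfl
    · simpa using hu a hxa
    · simpa [huv.symm] using hv a hxa
  by_cases h : ∃ a : G.edgeSet, a ≠ e ∧ EdgesMeet a.1 e.1
  · obtain ⟨a, hae, hmeet⟩ := h
    obtain ⟨p, hpa, hpe⟩ := (edgesMeet_map_iff φ a e).2 hmeet
    obtain ⟨u, hua, hue⟩ := hmeet
    obtain ⟨v, he⟩ := hue
    obtain ⟨q, hφe⟩ := hpe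
    have huv : u ≠ v := G.ne_of_adj (by rw [← mem_edgeSet, ← he]; exact e.2)
    exact ⟨u, v, p, q, huv, he, hφe, mem_map_of_mem_map_of_ne φ h₁ h₂ huv he hae hua hφe hpa⟩
  · obtain ⟨u, v, he⟩ : ∃ u v, e.1 = s(u, v) := ⟨_, _, e.1.out_eq.symm⟩
    obtain ⟨p, q, hφe⟩ : ∃ p q, (φ e).1 = s(p, q) := ⟨_, _, (φ e).1.out_eq.symm⟩
    have huv : u ≠ v := G.ne_of_adj (by rw [← mem_edgeSet, ← he]; exact e.2)
    have key : ∀ a : G.edgeSet, ∀ x ∈ a.1, x ∈ e.1 → a = e := fun a x hxa hxe => by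
      by_contra hae
      exact h ⟨a, hae, x, hxa, hxe⟩
    refine ⟨u, v, p, q, huv, he, hφe, fun a ha => ?_, fun a ha => ?_⟩ <;>
      rw [key a _ ha (by simp [he]), hφe] <;> simp

/-- An isomorphism of line graphs that preserves claws in both directions comes from a surjective
map of vertices. -/
theorem exists_surjective_of_preservesClaws (hG : G.Connected) (hH : H.Connected)
    (hne : G.edgeSet.Nonempty) (φ : G.lineGraph ≃g H.lineGraph)
    (h₁ : PreservesClaws φ) (h₂ : PreservesClaws φ.symm) :
    ∃ f : V → W, Function.Surjective f ∧ ∀ e : G.edgeSet, (φ e).1 = e.1.map f := by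
  choose l hl hmem using exists_endpoint_labelling φ h₁ h₂
  have hinc : ∀ u, ∃ e : G.edgeSet, u ∈ e.1 := fun u => by
    obtain ⟨v, hv⟩ := hG.exists_adj_of_edgeSet_nonempty hne u
    exact ⟨⟨s(u, v), hv⟩, by simp⟩
  choose n hn using hinc
  have hf : ∀ e : G.edgeSet, (φ e).1 = e.1.map fun u => l (n u) u := fun e => by
    rw [hl]
    refine Sym2.map_congr fun u hu => ?_
    by_cases hue : n u = e
    · rw [hue]
    · exact eq_of_mem_map_of_ne φ.injective hue (hmem e u hu _ (hn u)) (hmem e u hu _ hu)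
        (hmem _ u (hn u) _ (hn u)) (hmem _ u (hn u) _ hu)
  refine ⟨fun u => l (n u) u, fun w => ?_, hf⟩
  obtain ⟨e, he⟩ := hne
  obtain ⟨w', hw⟩ := hH.exists_adj_of_edgeSet_nonempty ⟨_, (φ ⟨e, he⟩).2⟩ w
  have hw' := hf (φ.symm ⟨s(w, w'), hw⟩)
  rw [RelIso.apply_symm_apply] at hw'
  have hmw : w ∈ s(w, w') := Sym2.mem_mk_left w w'
  rw [show s(w, w') = _ from hw'] at hmw
  obtain ⟨u, -, hu⟩ := Sym2.mem_map.1 hmw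
  exact ⟨u, hu⟩

theorem nonempty_iso_of_preservesClaws [Finite V] [Finite W] (hG : G.Connected) (hH : H.Connected)
    (hne : G.edgeSet.Nonempty) (φ : G.lineGraph ≃g H.lineGraph)
    (h₁ : PreservesClaws φ) (h₂ : PreservesClaws φ.symm) : Nonempty (G ≃g H) := by
  obtain ⟨f, hf, hφ⟩ := exists_surjective_of_preservesClaws hG hH hne φ h₁ h₂
  obtain ⟨g, hg, -⟩ := exists_surjective_of_preservesClaws hH hG
    (hne.elim fun e he => ⟨_, (φ ⟨e, he⟩).2⟩) φ.symm h₂ h₁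
  have hcard : Nat.card V = Nat.card W :=
    le_antisymm (Nat.card_le_card_of_surjective g hg) (Nat.card_le_card_of_surjective f hf)
  have hbij : Function.Bijective f := (Nat.bijective_iff_surjective_and_card f).2 ⟨hf, hcard⟩
  refine ⟨⟨Equiv.ofBijective f hbij, fun {u v} => ⟨fun h => ?_, fun h => ?_⟩⟩⟩
  · have huv := hφ (φ.symm ⟨s(f u, f v), h⟩)
    rw [RelIso.apply_symm_apply] at huv
    have := Sym2.map.injective hbij.injective (huv.symm.trans (Sym2.map_mk f u v).symm)
    rw [← mem_edgeSet, ← this]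
    exact Subtype.coe_prop _
  · have huv := hφ ⟨s(u, v), h⟩
    rw [Sym2.map_mk] at huv
    rw [← mem_edgeSet]
    exact huv ▸ Subtype.coe_prop _

theorem exists_triangle_of_edgesMeet {a b c : Sym2 W} (hab : EdgesMeet a b) (hac : EdgesMeet a c)
    (hbc : EdgesMeet b c) (h : ¬ ∃ w, w ∈ a ∧ w ∈ b ∧ w ∈ c) :
    ∃ p q r, p ≠ q ∧ p ≠ r ∧ q ≠ r ∧ a = s(q, r) ∧ b = s(p, r) ∧ c = s(p, q) := by
  obtain ⟨r, hra, hrb⟩ := hab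
  obtain ⟨q, hqa, hqc⟩ := hac
  obtain ⟨p, hpb, hpc⟩ := hbc
  have hpq : p ≠ q := by rintro rfl; exact h ⟨_, hqa, hpb, hpc⟩
  have hpr : p ≠ r := by rintro rfl; exact h ⟨_, hra, hpb, hpc⟩
  have hqr : q ≠ r := by rintro rfl; exact h ⟨_, hra, hrb, hqc⟩
  exact ⟨p, q, r, hpq, hpr, hqr, ((Sym2.mem_and_mem_iff hqr).1 ⟨hqa, hra⟩),
    ((Sym2.mem_and_mem_iff hpr).1 ⟨hpb, hrb⟩), ((Sym2.mem_and_mem_iff hpq).1 ⟨hpc, hqc⟩)⟩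

/-- If an isomorphism of line graphs sends a claw to a triangle, then the leaves of the claw are
adjacent only to the vertices of the claw. -/
theorem eq_of_adj_leaf (φ : G.lineGraph ≃g H.lineGraph) {v x y z t : V} {p q r : W}
    (hx : G.Adj v x) (hy : G.Adj v y) (hz : G.Adj v z) (hxy : x ≠ y) (hxz : x ≠ z)
    (hφx : (φ ⟨s(v, x), hx⟩).1 = s(q, r)) (hφy : (φ ⟨s(v, y), hy⟩).1 = s(p, r))
    (hφz : (φ ⟨s(v, z), hz⟩).1 = s(p, q)) (hxt : G.Adj x t) : t = v ∨ t = y ∨ t = z := by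
  obtain ⟨w, hw, hwx⟩ :=
    (edgesMeet_map_iff φ ⟨s(x, t), hxt⟩ ⟨s(v, x), hx⟩).2 ⟨x, by simp, by simp⟩
  have h2 := (edgesMeet_map_iff φ ⟨s(x, t), hxt⟩ ⟨s(v, y), hy⟩).1
  have h3 := (edgesMeet_map_iff φ ⟨s(x, t), hxt⟩ ⟨s(v, z), hz⟩).1
  rw [hφx, Sym2.mem_iff] at hwx
  rw [hφy] at h2
  rw [hφz] at h3
  rcases hwx with rfl | rfl
  · obtain ⟨u, hu, hu'⟩ := h3 ⟨w, hw, by simp⟩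
    have := hx.ne
    simp only [Sym2.mem_iff] at hu hu'
    grind
  · obtain ⟨u, hu, hu'⟩ := h2 ⟨w, hw, by simp⟩
    have := hx.ne
    simp only [Sym2.mem_iff] at hu hu'
    grind

/-- If an isomorphism of line graphs sends a claw to a triangle, then the center of the claw has
degree three. -/
theorem eq_of_adj_center (φ : G.lineGraph ≃g H.lineGraph) {v x y z t : V} {p q r : W}
    (hx : G.Adj v x) (hy : G.Adj v y) (hz : G.Adj v z)
    (hφx : (φ ⟨s(v, x), hx⟩).1 = s(q, r)) (hφy : (φ ⟨s(v, y), hy⟩).1 = s(p, r))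
    (hφz : (φ ⟨s(v, z), hz⟩).1 = s(p, q)) (hpq : p ≠ q) (hpr : p ≠ r) (hqr : q ≠ r)
    (hvt : G.Adj v t) : t = x ∨ t = y ∨ t = z := by
  have hinj {u : V} (hu : G.Adj v u) (h : (φ ⟨s(v, t), hvt⟩).1 = (φ ⟨s(v, u), hu⟩).1) : t = u := by
    exact Sym2.congr_right.1 (congrArg Subtype.val (φ.injective (Subtype.ext h)))
  have h1 := (edgesMeet_map_iff φ ⟨s(v, t), hvt⟩ ⟨s(v, x), hx⟩).2 ⟨v, by simp, by simp⟩
  have h2 := (edgesMeet_map_iff φ ⟨s(v, t), hvt⟩ ⟨s(v, y), hy⟩).2 ⟨v, by simp, by simp⟩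
  have h3 := (edgesMeet_map_iff φ ⟨s(v, t), hvt⟩ ⟨s(v, z), hz⟩).2 ⟨v, by simp, by simp⟩
  rw [hφx] at h1
  rw [hφy] at h2
  rw [hφz] at h3
  have hx' := hinj hx
  have hy' := hinj hy
  have hz' := hinj hz
  rw [hφx, ← Sym2.mem_and_mem_iff hqr] at hx'
  rw [hφy, ← Sym2.mem_and_mem_iff hpr] at hy'
  rw [hφz, ← Sym2.mem_and_mem_iff hpq] at hz'
  simp only [EdgesMeet, Sym2.mem_iff] at h1 h2 h3
  grind

/-- If an isomorphism of line graphs sends a claw to a triangle, then it sends an edge between two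
leaves of the claw to an edge joining the triangle to an outside vertex. -/
theorem exists_map_leaves_eq (φ : G.lineGraph ≃g H.lineGraph) {v x y z : V} {p q r : W}
    (hx : G.Adj v x) (hy : G.Adj v y) (hz : G.Adj v z) (hxz : x ≠ z) (hyz : y ≠ z)
    (hφx : (φ ⟨s(v, x), hx⟩).1 = s(q, r)) (hφy : (φ ⟨s(v, y), hy⟩).1 = s(p, r))
    (hφz : (φ ⟨s(v, z), hz⟩).1 = s(p, q)) (hxy : G.Adj x y) :
    ∃ w, w ≠ p ∧ w ≠ q ∧ w ≠ r ∧ (φ ⟨s(x, y), hxy⟩).1 = s(r, w) := by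
  have h1 := (edgesMeet_map_iff φ ⟨s(x, y), hxy⟩ ⟨s(v, x), hx⟩).2 ⟨x, by simp, by simp⟩
  have h3 := (edgesMeet_map_iff φ ⟨s(x, y), hxy⟩ ⟨s(v, z), hz⟩).not.2
    (by simp [EdgesMeet, hx.ne', hy.ne', hxz, hyz])
  rw [hφx] at h1
  rw [hφz] at h3
  have hp : p ∉ (φ ⟨s(x, y), hxy⟩).1 := fun hp => h3 ⟨p, hp, by simp⟩
  have hq : q ∉ (φ ⟨s(x, y), hxy⟩).1 := fun hq => h3 ⟨q, hq, by simp⟩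
  obtain ⟨t, ht, htr⟩ := h1
  obtain rfl | rfl := Sym2.mem_iff.1 htr
  · exact absurd ht hq
  obtain ⟨w, hw⟩ := ht
  have htw : H.Adj t w := by rw [← mem_edgeSet, ← hw]; exact Subtype.coe_prop _
  rw [hw] at hp hq
  simp only [Sym2.mem_iff, not_or] at hp hq
  exact ⟨w, Ne.symm hp.2, Ne.symm hq.2, htw.ne', hw⟩

/-- If an isomorphism of line graphs sends a claw to a triangle and some two leaves of the claw are
adjacent, then the edges between leaves are sent to edges with a common endpoint outside the
triangle. -/
theorem exists_forall_map_leaves_eq (φ : G.lineGraph ≃g H.lineGraph) {v x y z : V} {p q r : W}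
    (hx : G.Adj v x) (hy : G.Adj v y) (hz : G.Adj v z) (hxy : x ≠ y) (hxz : x ≠ z) (hyz : y ≠ z)
    (hφx : (φ ⟨s(v, x), hx⟩).1 = s(q, r)) (hφy : (φ ⟨s(v, y), hy⟩).1 = s(p, r))
    (hφz : (φ ⟨s(v, z), hz⟩).1 = s(p, q)) (hpq : p ≠ q) (hpr : p ≠ r) (hqr : q ≠ r)
    (h : G.Adj y z ∨ G.Adj x z ∨ G.Adj x y) :
    ∃ w, w ≠ p ∧ w ≠ q ∧ w ≠ r ∧
      (∀ h : G.Adj y z, (φ ⟨s(y, z), h⟩).1 = s(p, w)) ∧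
      (∀ h : G.Adj x z, (φ ⟨s(x, z), h⟩).1 = s(q, w)) ∧
      (∀ h : G.Adj x y, (φ ⟨s(x, y), h⟩).1 = s(r, w)) := by
  have h1 := exists_map_leaves_eq φ hy hz hx hxy.symm hxz.symm (hφy.trans Sym2.eq_swap)
    (hφz.trans Sym2.eq_swap) hφx
  have h2 := exists_map_leaves_eq φ hx hz hy hxy hyz.symm (hφx.trans Sym2.eq_swap) hφz hφy
  have h3 := exists_map_leaves_eq φ hx hy hz hxz hyz hφx hφy hφz
  have h12 (h h') := (edgesMeet_map_iff φ ⟨s(y, z), h⟩ ⟨s(x, z), h'⟩).2 ⟨z, by simp, by simp⟩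
  have h13 (h h') := (edgesMeet_map_iff φ ⟨s(y, z), h⟩ ⟨s(x, y), h'⟩).2 ⟨y, by simp, by simp⟩
  have h23 (h h') := (edgesMeet_map_iff φ ⟨s(x, z), h⟩ ⟨s(x, y), h'⟩).2 ⟨x, by simp, by simp⟩
  have key {a b c d : W} (h : EdgesMeet s(a, b) s(c, d)) (hac : a ≠ c) (had : d ≠ a) (hbc : b ≠ c) :
      d = b := by
    simp only [EdgesMeet, Sym2.mem_iff] at h
    grind
  choose w₁ hq₁ hr₁ hp₁ hw₁ using h1
  choose w₂ hp₂ hr₂ hq₂ hw₂ using h2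
  choose w₃ hp₃ hq₃ hr₃ hw₃ using h3
  have e12 (h h') : w₂ h' = w₁ h :=
    key (by simpa only [hw₁, hw₂] using h12 h h') hpq (hp₂ _) (hq₁ _)
  have e13 (h h') : w₃ h' = w₁ h :=
    key (by simpa only [hw₁, hw₃] using h13 h h') hpr (hp₃ _) (hr₁ _)
  have e23 (h h') : w₃ h' = w₂ h :=
    key (by simpa only [hw₂, hw₃] using h23 h h') hqr (hq₃ _) (hr₂ _)
  by_cases hA : G.Adj y z
  · exact ⟨w₁ hA, hp₁ _, hq₁ _, hr₁ _, hw₁, fun h => by rw [hw₂, e12 hA],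
      fun h => by rw [hw₃, e13 hA]⟩
  by_cases hB : G.Adj x z
  · exact ⟨w₂ hB, hp₂ _, hq₂ _, hr₂ _, fun h => absurd h hA, hw₂, fun h => by rw [hw₃, e23 hB]⟩
  have hC : G.Adj x y := by tauto
  exact ⟨w₃ hC, hp₃ _, hq₃ _, hr₃ _, fun h => absurd h hA, fun h => absurd h hB, hw₃⟩

/-- The adjacency matrix of a claw with center `0`, together with edges between its leaves
prescribed by `a` (for `2, 3`), `b` (for `1, 3`) and `c` (for `1, 2`). -/
def clawMatrix (a b c : Bool) : Fin 4 → Fin 4 → Bool :=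
  ![![false, true, true, true], ![true, false, c, b], ![true, c, false, a], ![true, b, a, false]]

/-- The adjacency matrix of a triangle on `1, 2, 3`, together with edges from `0` to `1`, `2`, `3`
prescribed by `a`, `b`, `c`. -/
def triangleMatrix (a b c : Bool) : Fin 4 → Fin 4 → Bool :=
  ![![false, a, b, c], ![a, false, true, true], ![b, true, false, true], ![c, true, true, false]]

theorem exists_perm_clawMatrix (a b c : Bool) (h : (a || b || c) = true) :
    ∃ σ : Equiv.Perm (Fin 4), ∀ i j,
      clawMatrix a b c i j = triangleMatrix a b c (σ i) (σ j) := by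
  revert a b c
  decide

theorem nonempty_iso_of_bijective {ι : Type*} {f : ι → V} {g : ι → W} (hf : Function.Bijective f)
    (hg : Function.Bijective g) (σ : Equiv.Perm ι)
    (h : ∀ i j, G.Adj (f i) (f j) ↔ H.Adj (g (σ i)) (g (σ j))) : Nonempty (G ≃g H) := by
  let F : G.comap f ≃g G := ⟨Equiv.ofBijective f hf, Iff.rfl⟩
  let K : H.comap (g ∘ σ) ≃g H := ⟨Equiv.ofBijective _ (hg.comp σ.bijective), Iff.rfl⟩
  have hFK : G.comap f = H.comap (g ∘ σ) := by ext i j; exact h i j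
  exact ⟨F.symm.trans ((Iso.refl.trans (hFK ▸ Iso.refl)).trans K)⟩

theorem bijective_vec {v x y z : V} (hvx : v ≠ x) (hvy : v ≠ y) (hvz : v ≠ z) (hxy : x ≠ y)
    (hxz : x ≠ z) (hyz : y ≠ z) (h : ∀ t, t = v ∨ t = x ∨ t = y ∨ t = z) :
    Function.Bijective ![v, x, y, z] := by
  constructor
  · intro i j
    fin_cases i <;> fin_cases j <;> simp [*, Ne.symm, eq_comm]
  · intro t
    rcases h t with rfl | rfl | rfl | rfl
    exacts [⟨0, rfl⟩, ⟨1, rfl⟩, ⟨2, rfl⟩, ⟨3, rfl⟩]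

theorem nonempty_iso_of_not_preservesClaws (hG : G.Connected) (hH : H.Connected)
    (hclaw : ¬ Nonempty (G ≃g claw)) (φ : G.lineGraph ≃g H.lineGraph)
    (h : ¬ PreservesClaws φ) : Nonempty (G ≃g H) := by
  classical
  unfold PreservesClaws at h
  push Not at h
  obtain ⟨⟨_, hx⟩, ⟨_, hy⟩, ⟨_, hz⟩, hab, hac, hbc, ⟨v, ⟨x, rfl⟩, ⟨y, rfl⟩, ⟨z, rfl⟩⟩, hw⟩ := h
  have hxy : x ≠ y := fun h => hab (by simp [h])
  have hxz : x ≠ z := fun h => hac (by simp [h])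
  have hyz : y ≠ z := fun h => hbc (by simp [h])
  rw [mem_edgeSet] at hx hy hz
  obtain ⟨p, q, r, hpq, hpr, hqr, hφx, hφy, hφz⟩ := exists_triangle_of_edgesMeet
    ((edgesMeet_map_iff φ ⟨s(v, x), hx⟩ ⟨s(v, y), hy⟩).2 ⟨v, by simp, by simp⟩)
    ((edgesMeet_map_iff φ ⟨s(v, x), hx⟩ ⟨s(v, z), hz⟩).2 ⟨v, by simp, by simp⟩)
    ((edgesMeet_map_iff φ ⟨s(v, y), hy⟩ ⟨s(v, z), hz⟩).2 ⟨v, by simp, by simp⟩) (by simpa using hw)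
  have hV (t : V) : t = v ∨ t = x ∨ t = y ∨ t = z := by
    obtain ⟨P⟩ := hG v t
    suffices ∀ a b, G.Walk a b → (a = v ∨ a = x ∨ a = y ∨ a = z) →
        b = v ∨ b = x ∨ b = y ∨ b = z from this v t P (Or.inl rfl)
    intro a b P
    induction P with
    | nil => exact id
    | cons hadj _ ih =>
      intro ha
      apply ih
      rcases ha with rfl | rfl | rfl | rfl
      · have := eq_of_adj_center φ hx hy hz hφx hφy hφz hpq hpr hqr hadj
        tauto
      · have := eq_of_adj_leaf φ hx hy hz hxy hxz hφx hφy hφz hadj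
        tauto
      · have := eq_of_adj_leaf φ hy hz hx hyz hxy.symm (hφy.trans Sym2.eq_swap)
          (hφz.trans Sym2.eq_swap) hφx hadj
        tauto
      · have := eq_of_adj_leaf φ hz hx hy hxz.symm hyz.symm hφz (hφx.trans Sym2.eq_swap)
          (hφy.trans Sym2.eq_swap) hadj
        tauto
  have hf := bijective_vec hx.ne hy.ne hz.ne hxy hxz hyz hV
  have hGadj : ∀ i j, G.Adj (![v, x, y, z] i) (![v, x, y, z] j) ↔
      clawMatrix (decide (G.Adj y z)) (decide (G.Adj x z)) (decide (G.Adj x y)) i j = true := by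
    intro i j
    fin_cases i <;> fin_cases j <;>
      simp [clawMatrix, hx, hy, hz, hx.symm, hy.symm, hz.symm, G.adj_comm y x, G.adj_comm z]
  have hsome : G.Adj y z ∨ G.Adj x z ∨ G.Adj x y := by
    by_contra hnone
    simp only [not_or] at hnone
    refine hclaw (nonempty_iso_of_bijective hf Function.bijective_id (Equiv.refl _) fun i j => ?_)
    rw [hGadj]
    simp only [hnone, decide_false]
    fin_cases i <;> fin_cases j <;> simp [clawMatrix, claw]
  obtain ⟨w, hwp, hwq, hwr, h1, h2, h3⟩ :=
    exists_forall_map_leaves_eq φ hx hy hz hxy hxz hyz hφx hφy hφz hpq hpr hqr hsome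
  have hE (s t : V) (hst : G.Adj s t) :
      (φ ⟨s(s, t), hst⟩).1 = s(q, r) ∨ (φ ⟨s(s, t), hst⟩).1 = s(p, r) ∨
      (φ ⟨s(s, t), hst⟩).1 = s(p, q) ∨ G.Adj y z ∧ (φ ⟨s(s, t), hst⟩).1 = s(p, w) ∨
      G.Adj x z ∧ (φ ⟨s(s, t), hst⟩).1 = s(q, w) ∨
      G.Adj x y ∧ (φ ⟨s(s, t), hst⟩).1 = s(r, w) := by
    have hswap : φ ⟨s(s, t), hst⟩ = φ ⟨s(t, s), hst.symm⟩ :=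
      congrArg φ (Subtype.ext Sym2.eq_swap)
    rcases hV s with rfl | rfl | rfl | rfl <;> rcases hV t with rfl | rfl | rfl | rfl <;>
      first
      | exact absurd hst (G.irrefl)
      | simp only [hφx, hφy, hφz, h1, h2, h3, hst, true_and, true_or, or_true]
      | (rw [hswap]
         simp only [hφx, hφy, hφz, h1, h2, h3, hst.symm, true_and, true_or, or_true])
  have hHE (s t : W) (hst : H.Adj s t) :
      s(s, t) = s(q, r) ∨ s(s, t) = s(p, r) ∨ s(s, t) = s(p, q) ∨ G.Adj y z ∧ s(s, t) = s(p, w) ∨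
      G.Adj x z ∧ s(s, t) = s(q, w) ∨ G.Adj x y ∧ s(s, t) = s(r, w) := by
    obtain ⟨⟨⟨a, b⟩, hab⟩, he⟩ := φ.surjective ⟨s(s, t), hst⟩
    have := hE a b hab
    rwa [show φ ⟨s(a, b), hab⟩ = _ from he] at this
  have hHadj {s t : W} {e : G.edgeSet} (he : (φ e).1 = s(s, t)) : H.Adj s t := by
    rw [← mem_edgeSet, ← he]
    exact Subtype.coe_prop _
  have hHqr := hHadj hφx
  have hHpr := hHadj hφy
  have hHpq := hHadj hφz
  have hwp' : H.Adj w p ↔ G.Adj y z := by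
    refine ⟨fun h => ?_, fun h => (hHadj (h1 h)).symm⟩
    have := hHE _ _ h
    simp only [Sym2.eq_iff] at this
    grind
  have hwq' : H.Adj w q ↔ G.Adj x z := by
    refine ⟨fun h => ?_, fun h => (hHadj (h2 h)).symm⟩
    have := hHE _ _ h
    simp only [Sym2.eq_iff] at this
    grind
  have hwr' : H.Adj w r ↔ G.Adj x y := by
    refine ⟨fun h => ?_, fun h => (hHadj (h3 h)).symm⟩
    have := hHE _ _ h
    simp only [Sym2.eq_iff] at this
    grind
  have hW (t : W) : t = w ∨ t = p ∨ t = q ∨ t = r := by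
    obtain ⟨u, hu⟩ := hH.exists_adj_of_edgeSet_nonempty ⟨s(q, r), hHqr⟩ t
    have := hHE _ _ hu
    simp only [Sym2.eq_iff] at this
    grind
  obtain ⟨σ, hσ⟩ := exists_perm_clawMatrix (decide (G.Adj y z)) (decide (G.Adj x z))
    (decide (G.Adj x y)) (by simpa [or_assoc] using hsome)
  have hHmat : ∀ i j, H.Adj (![w, p, q, r] i) (![w, p, q, r] j) ↔
      triangleMatrix (decide (G.Adj y z)) (decide (G.Adj x z)) (decide (G.Adj x y)) i j = true := by
    intro i j
    fin_cases i <;> fin_cases j <;>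
      simp [triangleMatrix, hHqr, hHpr, hHpq, hHqr.symm, hHpr.symm, hHpq.symm, hwp', hwq', hwr',
        H.adj_comm _ w]
  refine nonempty_iso_of_bijective hf (bijective_vec hwp hwq hwr hpq hpr hqr hW) σ fun i j => ?_
  rw [hGadj, hHmat, hσ]

end SimpleGraph

/-- Whitney's theorem. -/
theorem stmt_16 {V W : Type*} [Fintype V] [Fintype W]
    (G : SimpleGraph V) (H : SimpleGraph W)
    (hGc : G.Connected) (hHc : H.Connected)
    (hG₃ : ¬ Nonempty (G ≃g completeGraph (Fin 3)))
    (hGclaw : ¬ Nonempty (G ≃g claw))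
    (hH₃ : ¬ Nonempty (H ≃g completeGraph (Fin 3)))
    (hHclaw : ¬ Nonempty (H ≃g claw))
    (hL : Nonempty (G.lineGraph ≃g H.lineGraph)) :
    Nonempty (G ≃g H) := by
  obtain ⟨φ⟩ := hL
  by_cases h₁ : PreservesClaws φ
  swap
  · exact nonempty_iso_of_not_preservesClaws hGc hHc hGclaw φ h₁
  by_cases h₂ : PreservesClaws φ.symm
  swap
  · exact (nonempty_iso_of_not_preservesClaws hHc hGc hHclaw φ.symm h₂).map Iso.symm
  by_cases hne : G.edgeSet.Nonempty
  · exact nonempty_iso_of_preservesClaws hGc hHc hne φ h₁ h₂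
  · have hne' : ¬ H.edgeSet.Nonempty := fun ⟨e, he⟩ => hne ⟨_, (φ.symm ⟨e, he⟩).2⟩
    rw [Set.not_nonempty_iff_eq_empty, edgeSet_eq_empty] at hne hne'
    subst hne hne'
    obtain ⟨_, _⟩ := connected_bot_iff.1 hGc
    obtain ⟨_, _⟩ := connected_bot_iff.1 hHc
    obtain ⟨_⟩ := nonempty_unique V
    obtain ⟨_⟩ := nonempty_unique W
    exact ⟨Equiv.ofUnique V W, by simp⟩
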